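/- Let F be a proper filter in S and let s ∈ F. Then β_s(d(F) ∩ E) = d(F⁻¹) ∩ E; that is, {f ∈ E : s·e·s⁻¹ ≤ f for some e ∈ d(F) ∩ E} equals r(F) ∩ E, the set of idempotents in the range filter of F. -/

import Mathlib

/-- An inverse semigroup with zero: every element `a` has a unique `a⁻¹` with
`a * a⁻¹ * a = a` and `a⁻¹ * a * a⁻¹ = a⁻¹`, and `0` is absorbing. -/
class InvSemigroupWithZero (S : Type*) extends Semigroup S, Zero S, Inv S where
  mul_inv_mul : ∀ a : S, a * a⁻¹ * a = a
  inv_mul_inv : ∀ a : S, a⁻¹ * a * a⁻¹ = a⁻¹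
  inv_unique : ∀ a b : S, a * b * a = a → b * a * b = b → b = a⁻¹
  zero_mul : ∀ a : S, 0 * a = 0
  mul_zero : ∀ a : S, a * 0 = 0

namespace InvSemigroupWithZero

variable {S : Type*} [InvSemigroupWithZero S]

/-- The natural partial order on `S`: `a ≤ b` iff `a = a * a⁻¹ * b`. -/
def sle (a b : S) : Prop := a = a * a⁻¹ * b

/-- `↓s`, the down-set of `s` w.r.t. the natural partial order. -/
def dwn (s : S) : Set S := {t : S | sle t s}

/-- `↑A`, the up-set generated by `A` w.r.t. the natural partial order. -/
def up (A : Set S) : Set S := {b : S | ∃ a ∈ A, sle a b}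

/-- A filter in `S`: a nonempty down-directed up-set. -/
def IsFilt (F : Set S) : Prop :=
  F.Nonempty ∧ up F = F ∧ ∀ a ∈ F, ∀ b ∈ F, ∃ c ∈ F, sle c a ∧ sle c b

/-- A proper filter: a filter not containing `0`. -/
def IsPFilt (F : Set S) : Prop := IsFilt F ∧ (0 : S) ∉ F

/-- An ultrafilter: a proper filter maximal among proper filters. -/
def IsUltra (U : Set S) : Prop :=
  IsPFilt U ∧ ∀ G : Set S, IsPFilt G → U ⊆ G → U = G

/-- The set `E` of idempotents of `S`. -/
def E (S : Type*) [InvSemigroupWithZero S] : Set S := {e : S | e * e = e}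

/-- `F⁻¹ = {a⁻¹ : a ∈ F}`. -/
def finv (F : Set S) : Set S := (fun a : S => a⁻¹) '' F

/-- `F · G = ↑{fg : f ∈ F, g ∈ G}`. -/
def fmul (F G : Set S) : Set S := up (Set.image2 (· * ·) F G)

/-- The source `d(F) := F⁻¹ · F`. -/
def src (F : Set S) : Set S := fmul (finv F) F

/-- The range `r(F) := F · F⁻¹`. -/
def rng (F : Set S) : Set S := fmul F (finv F)

/-- The natural partial order on the idempotents: `e ≤ f` iff `e = e * f`. -/
def ele (e f : S) : Prop := e = e * f

/-- The down-set of an idempotent `e` inside `E`. -/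
def edwn (e : S) : Set S := {f : S | f ∈ E S ∧ ele f e}

/-- The up-set generated by `A` inside `E`. -/
def eup (A : Set S) : Set S := {f : S | f ∈ E S ∧ ∃ a ∈ A, ele a f}

/-- An `E`-filter: a proper filter of the inverse semigroup `E` of idempotents. -/
def IsEFilt (ξ : Set S) : Prop :=
  ξ ⊆ E S ∧ ξ.Nonempty ∧ eup ξ = ξ ∧
    (∀ a ∈ ξ, ∀ b ∈ ξ, ∃ c ∈ ξ, ele c a ∧ ele c b) ∧ (0 : S) ∉ ξ

/-- An `E`-ultrafilter: an `E`-filter maximal among `E`-filters. -/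
def IsEUltra (ξ : Set S) : Prop :=
  IsEFilt ξ ∧ ∀ η : Set S, IsEFilt η → ξ ⊆ η → ξ = η

/-- `β_s(ξ) = {f ∈ E : s·e·s⁻¹ ≤ f for some e ∈ ξ}`. -/
def beta (s : S) (ξ : Set S) : Set S :=
  {f : S | f ∈ E S ∧ ∃ e ∈ ξ, sle (s * e * s⁻¹) f}

/-- The set of proper filters in `S`. -/
abbrev PFilt (S : Type*) [InvSemigroupWithZero S] := {F : Set S // IsPFilt F}

/-- The patch topology on the set of proper filters, generated by the sets
`F(s;T) = {F : s ∈ F, F ∩ T = ∅}` for `s ∈ S` and finite `T ⊆ ↓s`. -/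
instance patchTopology : TopologicalSpace (PFilt S) :=
  TopologicalSpace.generateFrom
    {O : Set (PFilt S) | ∃ (s : S) (T : Set S), T.Finite ∧ T ⊆ dwn s ∧
      O = {F : PFilt S | s ∈ F.1 ∧ F.1 ∩ T = ∅}}

/-- The set of idempotent proper filters in `S`. -/
abbrev IPFilt (S : Type*) [InvSemigroupWithZero S] :=
  {F : Set S // IsPFilt F ∧ (F ∩ E S).Nonempty}

/-- The subspace topology induced by the patch topology on proper filters. -/
instance : TopologicalSpace (IPFilt S) :=
  TopologicalSpace.induced (fun F => (⟨F.1, F.2.1⟩ : PFilt S)) inferInstance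

/-- The set of `E`-filters. -/
abbrev EFilt (S : Type*) [InvSemigroupWithZero S] := {ξ : Set S // IsEFilt ξ}

/-- The patch topology on the set of `E`-filters, generated by the sets
`P(e;X) = {ξ : e ∈ ξ, ξ ∩ X = ∅}` for `e ∈ E` and finite `X ⊆ ↓e ∩ E`. -/
instance : TopologicalSpace (EFilt S) :=
  TopologicalSpace.generateFrom
    {O : Set (EFilt S) | ∃ (e : S) (X : Set S), e ∈ E S ∧ X.Finite ∧ X ⊆ edwn e ∧
      O = {ξ : EFilt S | e ∈ ξ.1 ∧ ξ.1 ∩ X = ∅}}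

/-- The set of ultrafilters in `S`. -/
abbrev UFilt (S : Type*) [InvSemigroupWithZero S] := {U : Set S // IsUltra U}

/-- The subspace topology induced by the patch topology on proper filters. -/
instance : TopologicalSpace (UFilt S) :=
  TopologicalSpace.induced (fun U => (⟨U.1, U.2.1⟩ : PFilt S)) inferInstance

end InvSemigroupWithZero

open InvSemigroupWithZero

namespace InvSemigroupWithZero

section InverseSemigroup

variable {S : Type*} [InvSemigroupWithZero S]

theorem inv_inv' (a : S) : a⁻¹⁻¹ = a :=
  (inv_unique a⁻¹ a (inv_mul_inv a) (mul_inv_mul a)).symm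

theorem inv_eq_self_of_mem_E {e : S} (he : e ∈ E S) : e⁻¹ = e := by
  have he' : e * e = e := he
  exact (inv_unique e e (by rw [he', he']) (by rw [he', he'])).symm

theorem mul_inv_mem_E (a : S) : a * a⁻¹ ∈ E S := by
  change a * a⁻¹ * (a * a⁻¹) = a * a⁻¹
  rw [← mul_assoc, mul_inv_mul]

theorem inv_mul_mem_E (a : S) : a⁻¹ * a ∈ E S := by
  change a⁻¹ * a * (a⁻¹ * a) = a⁻¹ * a
  rw [← mul_assoc, inv_mul_inv]

theorem mul_mem_E {e f : S} (he : e ∈ E S) (hf : f ∈ E S) : e * f ∈ E S := by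
  have he' : ∀ x, e * (e * x) = e * x := fun x => by rw [← mul_assoc, show e * e = e from he]
  have hf' : ∀ x, f * (f * x) = f * x := fun x => by rw [← mul_assoc, show f * f = f from hf]
  have h₁ := mul_inv_mul (e * f)
  have h₂ := inv_mul_inv (e * f)
  generalize hx : (e * f)⁻¹ = x at h₁ h₂
  simp only [mul_assoc] at h₁ h₂
  have h₂' : ∀ y, x * (e * (f * (x * y))) = x * y := fun y => by
    conv_rhs => rw [← h₂]
    simp only [mul_assoc]
  have h₃ : f * x * e = x := by
    rw [← hx]
    refine inv_unique (e * f) _ ?_ ?_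
    · rw [hx]; simp only [mul_assoc, he', hf', h₁]
    · rw [hx]; simp only [mul_assoc, he', hf', h₂']
  have h₄ : x ∈ E S := by
    change x * x = x
    conv_lhs => rw [← h₃]
    conv_rhs => rw [← h₃]
    simp only [mul_assoc, h₂']
  have h₅ : e * f = x := by rw [← inv_inv' (e * f), hx, inv_eq_self_of_mem_E h₄]
  rwa [h₅]

theorem mul_comm_of_mem_E {e f : S} (he : e ∈ E S) (hf : f ∈ E S) : e * f = f * e := by
  have he' : ∀ x, e * (e * x) = e * x := fun x => by rw [← mul_assoc, show e * e = e from he]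
  have hf' : ∀ x, f * (f * x) = f * x := fun x => by rw [← mul_assoc, show f * f = f from hf]
  have hef : e * f * (e * f) = e * f := mul_mem_E he hf
  have hfe : f * e * (f * e) = f * e := mul_mem_E hf he
  simp only [mul_assoc] at hef hfe
  rw [← inv_eq_self_of_mem_E (mul_mem_E he hf)]
  refine (inv_unique (e * f) (f * e) ?_ ?_).symm
  · simp only [mul_assoc, he', hf', hef]
  · simp only [mul_assoc, he', hf', hfe]

theorem mul_inv_rev' (a b : S) : (a * b)⁻¹ = b⁻¹ * a⁻¹ := by
  have h := mul_comm_of_mem_E (mul_inv_mem_E b) (inv_mul_mem_E a)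
  refine (inv_unique (a * b) _ ?_ ?_).symm
  · calc a * b * (b⁻¹ * a⁻¹) * (a * b) = a * (b * b⁻¹ * (a⁻¹ * a)) * b := by
          simp only [mul_assoc]
      _ = (a * a⁻¹ * a) * (b * b⁻¹ * b) := by rw [h]; simp only [mul_assoc]
      _ = a * b := by rw [mul_inv_mul, mul_inv_mul]
  · calc b⁻¹ * a⁻¹ * (a * b) * (b⁻¹ * a⁻¹) = b⁻¹ * (a⁻¹ * a * (b * b⁻¹)) * a⁻¹ := by
          simp only [mul_assoc]
      _ = (b⁻¹ * b * b⁻¹) * (a⁻¹ * a * a⁻¹) := by rw [← h]; simp only [mul_assoc]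
      _ = b⁻¹ * a⁻¹ := by rw [inv_mul_inv, inv_mul_inv]

theorem conj_mem_E (a : S) {e : S} (he : e ∈ E S) : a * e * a⁻¹ ∈ E S := by
  have he' : e * e = e := he
  have h : a * e * a⁻¹ = (a * e) * (a * e)⁻¹ := by
    rw [mul_inv_rev', inv_eq_self_of_mem_E he, ← mul_assoc, mul_assoc a e e, he']
  rw [h]
  exact mul_inv_mem_E _

theorem sle_of_eq_mul_left {a b e : S} (he : e ∈ E S) (h : a = e * b) : sle a b := by
  have he' : e * e = e := he
  have hc := mul_comm_of_mem_E he (mul_inv_mem_E b)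
  change a = a * a⁻¹ * b
  rw [h, mul_inv_rev', inv_eq_self_of_mem_E he]
  calc e * b = e * e * (b * b⁻¹ * b) := by rw [mul_inv_mul, he']
    _ = e * (e * (b * b⁻¹)) * b := by simp only [mul_assoc]
    _ = e * b * (b⁻¹ * e) * b := by rw [hc]; simp only [mul_assoc]

theorem sle_iff_exists_mul_right {a b : S} : sle a b ↔ ∃ e ∈ E S, a = b * e := by
  constructor
  · intro h
    refine ⟨b⁻¹ * (a * a⁻¹) * b, ?_, ?_⟩
    · simpa only [inv_inv'] using conj_mem_E b⁻¹ (mul_inv_mem_E a)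
    · calc a = a * a⁻¹ * (b * b⁻¹ * b) := by rw [mul_inv_mul]; exact h
        _ = a * a⁻¹ * (b * b⁻¹) * b := by simp only [mul_assoc]
        _ = b * (b⁻¹ * (a * a⁻¹) * b) := by
          rw [mul_comm_of_mem_E (mul_inv_mem_E a) (mul_inv_mem_E b)]; simp only [mul_assoc]
  · rintro ⟨e, he, rfl⟩
    refine sle_of_eq_mul_left (conj_mem_E b he) ?_
    calc b * e = b * b⁻¹ * b * e := by rw [mul_inv_mul]
      _ = b * (b⁻¹ * b * e) := by simp only [mul_assoc]
      _ = b * e * b⁻¹ * b := by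
        rw [mul_comm_of_mem_E (inv_mul_mem_E b) he]; simp only [mul_assoc]

theorem sle_trans {a b c : S} (hab : sle a b) (hbc : sle b c) : sle a c := by
  refine sle_of_eq_mul_left (mul_mem_E (mul_inv_mem_E a) (mul_inv_mem_E b)) ?_
  rw [mul_assoc, ← show b = b * b⁻¹ * c from hbc]
  exact hab

theorem sle_refl (a : S) : sle a a := (mul_inv_mul a).symm

theorem sle_inv {a b : S} (h : sle a b) : sle a⁻¹ b⁻¹ := by
  obtain ⟨e, he, rfl⟩ := sle_iff_exists_mul_right.1 h
  refine sle_of_eq_mul_left he ?_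
  rw [mul_inv_rev', inv_eq_self_of_mem_E he]

theorem sle_mul_left {a b : S} (c : S) (h : sle a b) : sle (c * a) (c * b) := by
  obtain ⟨e, he, rfl⟩ := sle_iff_exists_mul_right.1 h
  exact sle_iff_exists_mul_right.2 ⟨e, he, (mul_assoc _ _ _).symm⟩

theorem sle_mul_right {a b : S} (c : S) (h : sle a b) : sle (a * c) (b * c) :=
  sle_of_eq_mul_left (mul_inv_mem_E a) (by rw [← mul_assoc, ← show a = a * a⁻¹ * b from h])

theorem sle_mul {a b c d : S} (h : sle a b) (h' : sle c d) : sle (a * c) (b * d) :=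
  sle_trans (sle_mul_right c h) (sle_mul_left b h')

theorem mul_inv_mul_self_of_sle {c s : S} (h : sle c s) : s * (c⁻¹ * c) = c := by
  obtain ⟨e, he, rfl⟩ := sle_iff_exists_mul_right.1 h
  have he' : e * e = e := he
  rw [mul_inv_rev', inv_eq_self_of_mem_E he]
  calc s * (e * s⁻¹ * (s * e)) = s * (e * (s⁻¹ * s)) * e := by simp only [mul_assoc]
    _ = s * s⁻¹ * s * (e * e) := by
      rw [mul_comm_of_mem_E he (inv_mul_mem_E s)]; simp only [mul_assoc]
    _ = s * e := by rw [mul_inv_mul, he']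

theorem conj_inv_mul_self_of_sle {c s : S} (h : sle c s) :
    s * (c⁻¹ * c) * s⁻¹ = c * c⁻¹ := by
  have hc := mul_inv_mul_self_of_sle h
  have hc' : c⁻¹ = c⁻¹ * c * s⁻¹ := by
    conv_lhs => rw [← hc]
    rw [mul_inv_rev', inv_eq_self_of_mem_E (inv_mul_mem_E c)]
  conv_rhs => rw [hc']
  rw [hc, ← mul_assoc, ← mul_assoc, mul_inv_mul]

theorem finv_finv (F : Set S) : finv (finv F) = F := by
  simp only [finv, Set.image_image, inv_inv', Set.image_id']

theorem src_finv (F : Set S) : src (finv F) = rng F := by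
  rw [src, rng, finv_finv]

theorem IsFilt.mem_src_iff {F : Set S} (hF : IsFilt F) {b : S} :
    b ∈ src F ↔ ∃ a ∈ F, sle (a⁻¹ * a) b := by
  constructor
  · rintro ⟨_, ⟨_, ⟨x, hx, rfl⟩, y, hy, rfl⟩, h⟩
    obtain ⟨c, hc, hcx, hcy⟩ := hF.2.2 x hx y hy
    exact ⟨c, hc, sle_trans (sle_mul (sle_inv hcx) hcy) h⟩
  · rintro ⟨a, ha, h⟩
    exact ⟨_, ⟨_, ⟨a, ha, rfl⟩, a, ha, rfl⟩, h⟩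

theorem IsFilt.mem_rng_iff {F : Set S} (hF : IsFilt F) {b : S} :
    b ∈ rng F ↔ ∃ a ∈ F, sle (a * a⁻¹) b := by
  constructor
  · rintro ⟨_, ⟨x, hx, _, ⟨y, hy, rfl⟩, rfl⟩, h⟩
    obtain ⟨c, hc, hcx, hcy⟩ := hF.2.2 x hx y hy
    exact ⟨c, hc, sle_trans (sle_mul hcx (sle_inv hcy)) h⟩
  · rintro ⟨a, ha, h⟩
    exact ⟨_, ⟨a, ha, _, ⟨a, ha, rfl⟩, rfl⟩, h⟩

theorem IsFilt.beta_src {F : Set S} (hF : IsFilt F) {s : S} (hs : s ∈ F) :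
    beta s (src F ∩ E S) = rng F ∩ E S := by
  ext f
  constructor
  · rintro ⟨hf, e, ⟨he, -⟩, hef⟩
    obtain ⟨a, ha, hae⟩ := hF.mem_src_iff.1 he
    obtain ⟨c, hc, hca, hcs⟩ := hF.2.2 a ha s hs
    have hce : sle (c⁻¹ * c) e := sle_trans (sle_mul (sle_inv hca) hca) hae
    refine ⟨hF.mem_rng_iff.2 ⟨c, hc, sle_trans ?_ hef⟩, hf⟩
    rw [← conj_inv_mul_self_of_sle hcs]
    exact sle_mul_right _ (sle_mul_left _ hce)
  · rintro ⟨hfr, hf⟩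
    obtain ⟨a, ha, haf⟩ := hF.mem_rng_iff.1 hfr
    obtain ⟨c, hc, hca, hcs⟩ := hF.2.2 a ha s hs
    refine ⟨hf, c⁻¹ * c, ⟨hF.mem_src_iff.2 ⟨c, hc, sle_refl _⟩, inv_mul_mem_E c⟩, ?_⟩
    rw [conj_inv_mul_self_of_sle hcs]
    exact sle_trans (sle_mul hca (sle_inv hca)) haf

end InverseSemigroup

end InvSemigroupWithZero

/-- If `F` is a proper filter and `s ∈ F`, then
`β_s(d(F) ∩ E) = d(F⁻¹) ∩ E = r(F) ∩ E`. -/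
theorem stmt_13 {S : Type*} [InvSemigroupWithZero S]
    (F : Set S) (hF : IsPFilt F) (s : S) (hs : s ∈ F) :
    beta s (src F ∩ E S) = src (finv F) ∩ E S ∧
    beta s (src F ∩ E S) = rng F ∩ E S := by
  rw [src_finv]
  exact ⟨hF.1.beta_src hs, hF.1.beta_src hs⟩
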